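/- arXiv:1508.01293 — 2 statements merged into one kernel-verified Lean document; each statement's English description precedes it below -/
import Mathlib

section
/- Let ℓ ≥ 5 be a prime and let G be a closed subgroup of Sp_{2g}(ℤ_ℓ) whose reduction modulo ℓ is all of Sp_{2g}(𝔽_ℓ). Then G = Sp_{2g}(ℤ_ℓ). -/
open Matrix

section Congruences

variable {R : Type*} [CommRing R]

/-- If `u ^ 2` is divisible by `ℓ ^ m` with `m ≥ 1`, then `(1 + u) ^ ℓ` is congruent to `1 + ℓ u`
modulo `ℓ ^ (m + 1)`, for every prime `ℓ ≥ 5`. -/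
theorem exists_one_add_pow_prime_eq {A : Type*} [Ring A] [Algebra R A] {ℓ : ℕ} (hp : ℓ.Prime)
    (h5 : 5 ≤ ℓ) {m : ℕ} (hm : 1 ≤ m) {u w : A} (h : u ^ 2 = (ℓ : R) ^ m • w) :
    ∃ z : A, (1 + u) ^ ℓ = 1 + (ℓ : R) • u + (ℓ : R) ^ (m + 1) • z := by
  let N : Submodule R A := LinearMap.range (LinearMap.lsmul R A ((ℓ : R) ^ (m + 1)))
  have hN : ∀ z : A, (ℓ : R) ^ (m + 1) • z ∈ N := fun z => ⟨z, rfl⟩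
  obtain ⟨n, rfl⟩ : ∃ n, ℓ = n + 2 := ⟨ℓ - 2, by omega⟩
  have hterm : ∀ k ∈ Finset.range (n + 1),
      u ^ (k + 1 + 1) * 1 ^ (n + 2 - (k + 1 + 1)) * ((n + 2).choose (k + 1 + 1) : A) ∈ N := by
    intro k hk
    rw [Finset.mem_range] at hk
    rw [one_pow, mul_one, add_assoc, one_add_one_eq_two]
    rcases Nat.lt_or_ge k n with hkn | hkn
    · obtain ⟨c, hc⟩ := hp.dvd_choose_self (k := k + 2) (by omega) (by omega)
      rw [hc, add_comm k 2, pow_add, h]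
      convert hN (w * u ^ k * (c : A)) using 1
      rw [Nat.cast_mul, ← mul_assoc, ← (Nat.cast_commute (n + 2) _).eq, mul_assoc,
        ← nsmul_eq_mul, ← Nat.cast_smul_eq_nsmul R, smul_mul_assoc, smul_mul_assoc, smul_smul,
        pow_succ']
    · obtain rfl : k = n := by omega
      obtain ⟨j, rfl⟩ : ∃ j, k = 2 + j := ⟨k - 2, by omega⟩
      rw [Nat.choose_self, Nat.cast_one, mul_one, show 2 + j + 2 = 2 + 2 + j by omega, pow_add,
        pow_add, h]
      convert hN (((2 + j + 2 : ℕ) : R) ^ (m - 1) • (w * w * u ^ j)) using 1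
      rw [smul_smul, ← pow_add, show m + 1 + (m - 1) = m + m by omega, pow_add]
      simp only [smul_mul_assoc, mul_smul_comm, smul_smul]
  obtain ⟨z, hz⟩ := N.sum_mem hterm
  refine ⟨z, ?_⟩
  rw [LinearMap.lsmul_apply] at hz
  rw [hz, add_comm 1 u, (Commute.one_right u).add_pow, Finset.sum_range_succ',
    Finset.sum_range_succ']
  simp only [zero_add, pow_one, pow_zero, one_pow, mul_one, Nat.choose_one_right,
    Nat.choose_zero_right, Nat.cast_one, Nat.cast_smul_eq_nsmul, nsmul_eq_mul,
    (Nat.cast_commute (n + 2) u).eq]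
  abel

variable {l : Type*} [DecidableEq l] [Fintype l]

/-- The set of matrices `X` such that `1 + ℓ ^ n X` is congruent modulo `ℓ ^ (n + 1)` to an element
of `G`. -/
def congruenceLayer (ℓ : ℕ) (G : Subgroup (symplecticGroup l R)) (n : ℕ) :
    Set (Matrix (l ⊕ l) (l ⊕ l) R) :=
  {X | ∃ A ∈ G, ∃ Y, (A : Matrix (l ⊕ l) (l ⊕ l) R) =
    1 + (ℓ : R) ^ n • X + (ℓ : R) ^ (n + 1) • Y}

variable {ℓ : ℕ} {G : Subgroup (symplecticGroup l R)} {n : ℕ}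

theorem zero_mem_congruenceLayer : (0 : Matrix (l ⊕ l) (l ⊕ l) R) ∈ congruenceLayer ℓ G n :=
  ⟨1, G.one_mem, 0, by simp⟩

theorem add_mem_congruenceLayer (hn : 1 ≤ n) {X X' : Matrix (l ⊕ l) (l ⊕ l) R}
    (hX : X ∈ congruenceLayer ℓ G n) (hX' : X' ∈ congruenceLayer ℓ G n) :
    X + X' ∈ congruenceLayer ℓ G n := by
  obtain ⟨A, hA, Y, hY⟩ := hX
  obtain ⟨A', hA', Y', hY'⟩ := hX'
  obtain ⟨n, rfl⟩ : ∃ k, n = k + 1 := ⟨n - 1, by omega⟩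
  refine ⟨A * A', G.mul_mem hA hA',
    Y + Y' + (ℓ : R) ^ n • ((X + (ℓ : R) • Y) * (X' + (ℓ : R) • Y')), ?_⟩
  rw [Submonoid.coe_mul, hY, hY']
  simp only [mul_add, add_mul, smul_mul_assoc, mul_smul_comm, one_mul, mul_one]
  module

theorem mem_congruenceLayer_succ (hp : ℓ.Prime) (h5 : 5 ≤ ℓ) (hn : 1 ≤ n)
    {X : Matrix (l ⊕ l) (l ⊕ l) R} (hX : X ∈ congruenceLayer ℓ G n) :
    X ∈ congruenceLayer ℓ G (n + 1) := by
  obtain ⟨A, hA, Y, hY⟩ := hX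
  have hsq : ((ℓ : R) ^ n • (X + (ℓ : R) • Y)) ^ 2 =
      (ℓ : R) ^ (n + 1) • ((ℓ : R) ^ (n - 1) • (X + (ℓ : R) • Y) ^ 2) := by
    rw [smul_pow, smul_smul, ← pow_mul, ← pow_add]
    congr 2
    omega
  obtain ⟨z, hz⟩ := exists_one_add_pow_prime_eq hp h5 (by omega) hsq
  refine ⟨A ^ ℓ, G.pow_mem hA ℓ, Y + z, ?_⟩
  rw [SubmonoidClass.coe_pow, hY, show (1 : Matrix (l ⊕ l) (l ⊕ l) R) + (ℓ : R) ^ n • X +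
    (ℓ : R) ^ (n + 1) • Y = 1 + (ℓ : R) ^ n • (X + (ℓ : R) • Y) by module, hz]
  module

theorem mem_congruenceLayer_one (hp : ℓ.Prime) (h5 : 5 ≤ ℓ) {X : Matrix (l ⊕ l) (l ⊕ l) R}
    (hX : X * X = 0) (h : ∃ A ∈ G, ∃ Y, (A : Matrix (l ⊕ l) (l ⊕ l) R) = 1 + X + (ℓ : R) • Y) :
    X ∈ congruenceLayer ℓ G 1 := by
  obtain ⟨A, hA, Y, hY⟩ := h
  have hsq : (X + (ℓ : R) • Y) ^ 2 = (ℓ : R) ^ 1 • (X * Y + Y * X + (ℓ : R) • (Y * Y)) := by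
    rw [pow_two]
    simp only [mul_add, add_mul, smul_mul_assoc, mul_smul_comm, hX]
    module
  obtain ⟨z, hz⟩ := exists_one_add_pow_prime_eq hp h5 le_rfl hsq
  refine ⟨A ^ ℓ, G.pow_mem hA ℓ, Y + z, ?_⟩
  rw [SubmonoidClass.coe_pow, hY, add_assoc, hz]
  module

theorem smul_vecMulVec_mul_J_mul_self (c : R) (v : l ⊕ l → R) :
    (c • vecMulVec v v * J l R) * (c • vecMulVec v v * J l R) = 0 := by
  have hv : v ⬝ᵥ (J l R *ᵥ v) = 0 := by
    simp [J, fromBlocks_mulVec, neg_mulVec, dotProduct, mul_comm]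
  have : vecMulVec v v * J l R * vecMulVec v v = 0 := by
    rw [mul_assoc, mul_vecMulVec, vecMulVec_mul_vecMulVec, hv]
    simp
  simp only [smul_mul_assoc, mul_smul_comm, ← mul_assoc, this, zero_mul, smul_zero]

theorem one_add_smul_vecMulVec_mul_J_mem (c : R) (v : l ⊕ l → R) :
    1 + c • vecMulVec v v * J l R ∈ symplecticGroup l R := by
  have hX := smul_vecMulVec_mul_J_mul_self c v
  set S := c • vecMulVec v v with hS
  have hSt : Sᵀ = S := by rw [hS, transpose_smul, transpose_vecMulVec]
  have hJ : S * J l R * J l R = -S := by rw [mul_assoc, J_squared, mul_neg, mul_one]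
  have h0 : S * J l R * S = 0 := by
    have := congrArg (· * J l R) hX
    simp only [zero_mul] at this
    rw [mul_assoc, hJ] at this
    simpa using this
  rw [SymplecticGroup.mem_iff, transpose_add, transpose_one, transpose_mul, hSt, J_transpose,
    add_mul, one_mul, mul_add, mul_one, neg_mul, mul_neg, add_mul, ← mul_assoc, ← mul_assoc,
    J_squared, hJ, neg_mul S, neg_mul (S * J l R), h0]
  simp

/-- Over a ring in which `2` is invertible, symmetric matrices are sums of multiples of squares
`v vᵀ`. -/
theorem Matrix.IsSymm.mem_closure_smul_vecMulVec {m : Type*} [Fintype m] [DecidableEq m]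
    (h2 : IsUnit (2 : R)) {S : Matrix m m R} (hS : S.IsSymm) :
    S ∈ AddSubmonoid.closure {T | ∃ (c : R) (v : m → R), T = c • vecMulVec v v} := by
  obtain ⟨d, hd⟩ := h2.exists_left_inv
  have hmem (c : R) (v : m → R) : c • vecMulVec v v ∈
      AddSubmonoid.closure {T | ∃ (c : R) (v : m → R), T = c • vecMulVec v v} :=
    AddSubmonoid.subset_closure ⟨c, v, rfl⟩
  let e (i : m) : m → R := Pi.single i 1
  have hsum : S = ∑ i, ∑ j, ((d * S i j) • vecMulVec (e i + e j) (e i + e j) +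
      (-(d * S i j)) • vecMulVec (e i) (e i) + (-(d * S i j)) • vecMulVec (e j) (e j)) := by
    have key (i j : m) : (d * S i j) • vecMulVec (e i + e j) (e i + e j) +
        (-(d * S i j)) • vecMulVec (e i) (e i) + (-(d * S i j)) • vecMulVec (e j) (e j) =
        d • (single i j (S i j) + (single i j (S i j))ᵀ) := by
      have hs : single i j (S i j) = S i j • vecMulVec (e i) (e j) := by
        simp [e, ← single_eq_single_vecMulVec_single]
      rw [hs, transpose_smul, transpose_vecMulVec, add_vecMulVec, vecMulVec_add, vecMulVec_add]
      module
    simp_rw [key, ← Finset.smul_sum, Finset.sum_add_distrib, ← transpose_sum,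
      ← matrix_eq_sum_single S, hS.eq, ← two_smul R S, smul_smul, hd, one_smul]
  rw [hsum]
  exact sum_mem fun i _ => sum_mem fun j _ => add_mem (add_mem (hmem _ _) (hmem _ _)) (hmem _ _)

theorem mul_J_mem_congruenceLayer (hp : ℓ.Prime) (h5 : 5 ≤ ℓ) (h2 : IsUnit (2 : R))
    (hG : ∀ M ∈ symplecticGroup l R, ∃ A ∈ G, ∃ Y,
      (A : Matrix (l ⊕ l) (l ⊕ l) R) = M + (ℓ : R) • Y)
    (hn : 1 ≤ n) {S : Matrix (l ⊕ l) (l ⊕ l) R} (hS : S.IsSymm) :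
    S * J l R ∈ congruenceLayer ℓ G n := by
  have hmem := hS.mem_closure_smul_vecMulVec h2
  clear hS
  induction hmem using AddSubmonoid.closure_induction with
  | mem T hT =>
    obtain ⟨c, v, rfl⟩ := hT
    induction n, hn using Nat.le_induction with
    | base =>
      exact mem_congruenceLayer_one hp h5 (smul_vecMulVec_mul_J_mul_self c v)
        (hG _ (one_add_smul_vecMulVec_mul_J_mem c v))
    | succ n hn ih => exact mem_congruenceLayer_succ hp h5 hn ih
  | zero => rw [zero_mul]; exact zero_mem_congruenceLayer
  | add T T' _ _ hT hT' => rw [add_mul]; exact add_mem_congruenceLayer hn hT hT'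

/-- A subgroup of the symplectic group surjecting onto the symplectic group modulo `ℓ` surjects
onto it modulo every power of `ℓ`. -/
theorem exists_mem_eq_add_pow_smul [IsDomain R] (hp : ℓ.Prime) (h5 : 5 ≤ ℓ) (hℓ : (ℓ : R) ≠ 0)
    (h2 : IsUnit (2 : R))
    (hG : ∀ M ∈ symplecticGroup l R, ∃ A ∈ G, ∃ Y,
      (A : Matrix (l ⊕ l) (l ⊕ l) R) = M + (ℓ : R) • Y)
    (hn : 1 ≤ n) (M : symplecticGroup l R) :
    ∃ A ∈ G, ∃ Y, (A : Matrix (l ⊕ l) (l ⊕ l) R) = M + (ℓ : R) ^ n • Y := by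
  induction n, hn using Nat.le_induction with
  | base => simpa using hG M M.2
  | succ n hn ih =>
    obtain ⟨A, hA, Y, hY⟩ := ih
    obtain ⟨d, hd⟩ := h2.exists_left_inv
    obtain ⟨k, rfl⟩ : ∃ k, n = k + 1 := ⟨n - 1, by omega⟩
    set q : R := (ℓ : R)
    -- `M = C * A` with `C = 1 + q ^ (k + 1) • Z`
    let C : symplecticGroup l R := M * A⁻¹
    let Z : Matrix (l ⊕ l) (l ⊕ l) R := -(Y * (A⁻¹ : symplecticGroup l R))
    have hAA : (A : Matrix (l ⊕ l) (l ⊕ l) R) * (A⁻¹ : symplecticGroup l R) = 1 := by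
      rw [← Submonoid.coe_mul, mul_inv_cancel, Submonoid.coe_one]
    have hC : (C : Matrix (l ⊕ l) (l ⊕ l) R) = 1 + q ^ (k + 1) • Z := by
      have hM : (M : Matrix (l ⊕ l) (l ⊕ l) R) = A - q ^ (k + 1) • Y := by rw [hY]; abel
      rw [Submonoid.coe_mul, hM, sub_mul, hAA, smul_mul_assoc, smul_neg, sub_eq_add_neg]
    have hskew : Z * J l R + J l R * Zᵀ = -(q ^ (k + 1) • (Z * J l R * Zᵀ)) := by
      have hmem := SymplecticGroup.mem_iff.1 C.2
      rw [hC] at hmem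
      apply smul_right_injective _ (pow_ne_zero (k + 1) hℓ)
      simp only [transpose_add, transpose_one, transpose_smul, mul_add, add_mul, one_mul, mul_one,
        smul_mul_assoc, mul_smul_comm] at hmem ⊢
      rw [← sub_eq_zero] at hmem ⊢
      rw [← hmem]
      module
    let S := d • (Z * J l R + (Z * J l R)ᵀ)
    have hS : S.IsSymm := by
      simp only [S, Matrix.IsSymm, transpose_smul, transpose_add, transpose_transpose]
      rw [add_comm]
    have hS_eq : S = Z * J l R + (d * q ^ (k + 1)) • (Z * J l R * Zᵀ) := by
      have hT : (Z * J l R)ᵀ = Z * J l R + q ^ (k + 1) • (Z * J l R * Zᵀ) := by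
        rw [transpose_mul, J_transpose, neg_mul, ← sub_eq_zero, ← neg_eq_zero,
          ← sub_eq_zero.2 hskew]
        abel
      have h1 : Z * J l R = (d * 2) • (Z * J l R) := by rw [hd, one_smul]
      rw [show S = d • (Z * J l R + (Z * J l R)ᵀ) from rfl, hT]
      nth_rw 4 [h1]
      module
    have hSJ : -S * J l R = Z - (d * q ^ (k + 1)) • (Z * J l R * Zᵀ * J l R) := by
      rw [hS_eq, neg_mul, add_mul, mul_assoc Z, J_squared, mul_neg, mul_one, smul_mul_assoc]
      abel
    obtain ⟨B, hB, W, hW⟩ := mul_J_mem_congruenceLayer hp h5 h2 hG hn hS.neg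
    have hBC : (B : Matrix (l ⊕ l) (l ⊕ l) R) =
        C + q ^ (k + 2) • (W - (d * q ^ k) • (Z * J l R * Zᵀ * J l R)) := by
      rw [hW, hSJ, hC]
      module
    have hCA : (C : Matrix (l ⊕ l) (l ⊕ l) R) * A = M := by
      rw [← Submonoid.coe_mul, inv_mul_cancel_right]
    refine ⟨B * A, G.mul_mem hB hA,
      (W - (d * q ^ k) • (Z * J l R * Zᵀ * J l R)) * A, ?_⟩
    rw [Submonoid.coe_mul, hBC, add_mul, hCA, smul_mul_assoc]

end Congruences

/-- Let `ℓ ≥ 5` be a prime, and let `G` be a closed subgroup of `Sp_{2g}(ℤ_ℓ)` whose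
reduction modulo `ℓ` is all of `Sp_{2g}(𝔽_ℓ)`.  Then `G = Sp_{2g}(ℤ_ℓ)`. -/
theorem closed_subgroup_sp_surjective_mod_ell (g ℓ : ℕ) [Fact (Nat.Prime ℓ)] (hℓ : 5 ≤ ℓ)
    (G : Subgroup (Matrix.symplecticGroup (Fin g) ℤ_[ℓ]))
    (hclosed : IsClosed (G : Set (Matrix.symplecticGroup (Fin g) ℤ_[ℓ])))
    (hsurj : ∀ B ∈ Matrix.symplecticGroup (Fin g) (ZMod ℓ),
      ∃ A ∈ G, (A : Matrix (Fin g ⊕ Fin g) (Fin g ⊕ Fin g) ℤ_[ℓ]).map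
        (PadicInt.toZMod : ℤ_[ℓ] →+* ZMod ℓ) = B) :
    G = ⊤ := by
  have hp : ℓ.Prime := Fact.out
  have h2 : IsUnit (2 : ℤ_[ℓ]) := by
    have h : IsUnit ((2 : ℕ) : ℤ_[ℓ]) := by
      rw [PadicInt.isUnit_iff, PadicInt.norm_natCast_eq_one_iff]
      exact (Nat.coprime_primes hp Nat.prime_two).2 (by omega)
    exact_mod_cast h
  have hG : ∀ M ∈ symplecticGroup (Fin g) ℤ_[ℓ], ∃ A ∈ G, ∃ Y,
      (A : Matrix (Fin g ⊕ Fin g) (Fin g ⊕ Fin g) ℤ_[ℓ]) = M + (ℓ : ℤ_[ℓ]) • Y := by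
    intro M hM
    obtain ⟨A, hA, hAM⟩ := hsurj _ (SymplecticGroup.map_mem hM PadicInt.toZMod)
    have hdvd (i j) : ∃ y, (A : Matrix (Fin g ⊕ Fin g) (Fin g ⊕ Fin g) ℤ_[ℓ]) i j - M i j =
        (ℓ : ℤ_[ℓ]) * y := by
      have h : (A : Matrix (Fin g ⊕ Fin g) (Fin g ⊕ Fin g) ℤ_[ℓ]) i j - M i j ∈
          RingHom.ker (PadicInt.toZMod (p := ℓ)) := by
        rw [RingHom.mem_ker, map_sub, sub_eq_zero]
        exact congrFun (congrFun hAM i) j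
      rwa [PadicInt.ker_toZMod, PadicInt.maximalIdeal_eq_span_p, Ideal.mem_span_singleton] at h
    choose Y hY using hdvd
    refine ⟨A, hA, Matrix.of Y, ?_⟩
    ext1 i j
    rw [Matrix.add_apply, Matrix.smul_apply, of_apply, smul_eq_mul, ← hY, add_sub_cancel]
  rw [eq_top_iff]
  intro M _
  choose A hA Y hY using fun n : ℕ => exists_mem_eq_add_pow_smul hp hℓ
    (Nat.cast_ne_zero.2 hp.ne_zero) h2 hG (Nat.le_add_left 1 n) M
  refine hclosed.mem_of_tendsto (f := A) (b := Filter.atTop) ?_ (Filter.Eventually.of_forall hA)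
  rw [tendsto_subtype_rng]
  refine tendsto_pi_nhds.2 fun i => tendsto_pi_nhds.2 fun j => ?_
  rw [tendsto_iff_norm_sub_tendsto_zero]
  have hlt : ‖(ℓ : ℤ_[ℓ])‖ < 1 := by
    rw [PadicInt.norm_p]
    exact inv_lt_one_of_one_lt₀ (by exact_mod_cast hp.one_lt)
  refine squeeze_zero (fun _ => norm_nonneg _) (fun n => ?_)
    ((tendsto_pow_atTop_nhds_zero_of_lt_one (norm_nonneg _) hlt).comp
      (Filter.tendsto_add_atTop_nat 1))
  rw [hY, Matrix.add_apply, add_sub_cancel_left, Matrix.smul_apply, smul_eq_mul, norm_mul, norm_pow]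
  exact mul_le_of_le_one_right (by positivity) (PadicInt.norm_le_one _)
end

section
/- Let ℓ ≥ 5 be a prime and let H be a closed subgroup of GSp_{2g}(ℤ_ℓ) whose reduction modulo ℓ contains Sp_{2g}(𝔽_ℓ). Then the closure of the commutator subgroup H' equals Sp_{2g}(ℤ_ℓ). -/
open Matrix

section SymplecticForm

variable {l R : Type*} [Fintype l] [DecidableEq l] [CommRing R]

/-- The standard alternating form attached to `Matrix.J`. -/
def sympForm (x y : l ⊕ l → R) : R := x ⬝ᵥ (J l R *ᵥ y)

lemma sympForm_add_left (x y z : l ⊕ l → R) :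
    sympForm (x + y) z = sympForm x z + sympForm y z := by
  simp [sympForm]

lemma sympForm_sub_left (x y z : l ⊕ l → R) :
    sympForm (x - y) z = sympForm x z - sympForm y z := by
  simp [sympForm]

lemma sympForm_smul_left (c : R) (x y : l ⊕ l → R) :
    sympForm (c • x) y = c * sympForm x y := by
  simp [sympForm]

lemma sympForm_add_right (x y z : l ⊕ l → R) :
    sympForm x (y + z) = sympForm x y + sympForm x z := by
  simp [sympForm, mulVec_add]

lemma sympForm_smul_right (c : R) (x y : l ⊕ l → R) :
    sympForm x (c • y) = c * sympForm x y := by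
  simp [sympForm, mulVec_smul]

lemma sympForm_eq_sum (x y : l ⊕ l → R) :
    sympForm x y = ∑ i, (x (Sum.inr i) * y (Sum.inl i) - x (Sum.inl i) * y (Sum.inr i)) := by
  have h (i : l) : (J l R *ᵥ y) (Sum.inl i) = - y (Sum.inr i) := by
    simp [J, mulVec, dotProduct, Matrix.one_apply, Fintype.sum_sum_type]
  have h' (i : l) : (J l R *ᵥ y) (Sum.inr i) = y (Sum.inl i) := by
    simp [J, mulVec, dotProduct, Matrix.one_apply, Fintype.sum_sum_type]
  rw [sympForm, dotProduct, Fintype.sum_sum_type, add_comm, ← Finset.sum_add_distrib]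
  simp [h, h', sub_eq_add_neg]

@[simp]
lemma sympForm_self (x : l ⊕ l → R) : sympForm x x = 0 := by
  simp [sympForm_eq_sum, mul_comm]

lemma sympForm_swap (x y : l ⊕ l → R) : sympForm x y = -sympForm y x := by
  simp only [sympForm_eq_sum, ← Finset.sum_neg_distrib]
  exact Finset.sum_congr rfl fun _ _ => by ring

lemma sympForm_single (a b : l ⊕ l) :
    sympForm (Pi.single a 1) (Pi.single b 1) = J l R a b := by
  simp [sympForm]

lemma sympForm_mulVec {A : Matrix (l ⊕ l) (l ⊕ l) R} (hA : A ∈ symplecticGroup l R)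
    (x y : l ⊕ l → R) : sympForm (A *ᵥ x) (A *ᵥ y) = sympForm x y := by
  rw [SymplecticGroup.mem_iff'] at hA
  rw [sympForm, ← vecMul_transpose, ← dotProduct_mulVec, mulVec_mulVec, mulVec_mulVec, hA,
    sympForm]

lemma mem_symplecticGroup_of_sympForm {A : Matrix (l ⊕ l) (l ⊕ l) R}
    (h : ∀ x y, sympForm (A *ᵥ x) (A *ᵥ y) = sympForm x y) : A ∈ symplecticGroup l R := by
  rw [SymplecticGroup.mem_iff']
  ext a b
  have := h (Pi.single a 1) (Pi.single b 1)
  rw [sympForm_single, sympForm, ← vecMul_transpose, ← dotProduct_mulVec, mulVec_mulVec,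
    mulVec_mulVec] at this
  simpa using this

/-- The matrix of the symplectic transvection `x ↦ x + c ω(w, x) w`. -/
def sympTransvection (w : l ⊕ l → R) (c : R) : Matrix (l ⊕ l) (l ⊕ l) R :=
  1 + c • (vecMulVec w w * J l R)

lemma sympTransvection_mulVec (w : l ⊕ l → R) (c : R) (x : l ⊕ l → R) :
    sympTransvection w c *ᵥ x = x + (c * sympForm w x) • w := by
  simp [sympTransvection, add_mulVec, smul_mulVec, ← mulVec_mulVec, vecMulVec_mulVec, sympForm,
    mul_smul]

lemma sympTransvection_mem (w : l ⊕ l → R) (c : R) :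
    sympTransvection w c ∈ symplecticGroup l R := by
  refine mem_symplecticGroup_of_sympForm fun x y => ?_
  simp only [sympTransvection_mulVec, sympForm_add_left, sympForm_add_right, sympForm_smul_left,
    sympForm_smul_right, sympForm_self]
  rw [sympForm_swap x w]
  ring

lemma vecMulVec_mul_J_sq (w : l ⊕ l → R) :
    (vecMulVec w w * J l R) * (vecMulVec w w * J l R) = 0 := by
  have : w ᵥ* J l R ⬝ᵥ w = 0 := by
    rw [← dotProduct_mulVec]; exact sympForm_self w
  rw [vecMulVec_mul, vecMulVec_mul_vecMulVec, this]
  simp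

end SymplecticForm

section Generation

variable {l F : Type*} [Fintype l] [DecidableEq l] [Field F]

lemma ext_mulVec_of_mem {A B : symplecticGroup l F}
    (h : ∀ x, (A : Matrix (l ⊕ l) (l ⊕ l) F) *ᵥ x = (B : Matrix (l ⊕ l) (l ⊕ l) F) *ᵥ x) :
    A = B :=
  Subtype.ext (Matrix.mulVec_injective (funext h))

/-- The transvection `sympTransvection w c` as an element of the symplectic group. -/
def spTransvection (w : l ⊕ l → F) (c : F) : symplecticGroup l F :=
  ⟨sympTransvection w c, sympTransvection_mem w c⟩

variable {T : Subgroup (symplecticGroup l F)} (hT : ∀ w c, spTransvection w c ∈ T)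

include hT

lemma exists_mulVec_eq_of_sympForm_ne_zero {x y : l ⊕ l → F} (h : sympForm x y ≠ 0) :
    ∃ τ ∈ T, τ.1 *ᵥ x = y ∧ ∀ z, sympForm x z = sympForm y z → τ.1 *ᵥ z = z := by
  refine ⟨spTransvection (x - y) (-(sympForm x y)⁻¹), hT _ _, ?_, fun z hz => ?_⟩
  · simp only [spTransvection, sympTransvection_mulVec, sympForm_sub_left, sympForm_self]
    rw [sympForm_swap y x, zero_sub, neg_neg, neg_mul, inv_mul_cancel₀ h,
      neg_smul, one_smul]
    abel
  · simp [spTransvection, sympTransvection_mulVec, sympForm_sub_left, hz]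

lemma exists_mulVec_eq_of_sympForm_ne_zero₂ {x v y : l ⊕ l → F} (h : sympForm x v ≠ 0)
    (h' : sympForm v y ≠ 0) :
    ∃ τ ∈ T, τ.1 *ᵥ x = y ∧
      ∀ z, sympForm x z = sympForm v z → sympForm v z = sympForm y z → τ.1 *ᵥ z = z := by
  obtain ⟨τ, hτ, hτx, hτz⟩ := exists_mulVec_eq_of_sympForm_ne_zero hT h
  obtain ⟨σ, hσ, hσx, hσz⟩ := exists_mulVec_eq_of_sympForm_ne_zero hT h'
  refine ⟨σ * τ, T.mul_mem hσ hτ, ?_, fun z h₁ h₂ => ?_⟩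
  · rw [Submonoid.coe_mul, ← mulVec_mulVec, hτx, hσx]
  · rw [Submonoid.coe_mul, ← mulVec_mulVec, hτz z h₁, hσz z h₂]

lemma exists_mulVec_eq {x y x' y' : l ⊕ l → F} (hx : sympForm x x' ≠ 0)
    (hy : sympForm y y' ≠ 0) :
    ∃ τ ∈ T, τ.1 *ᵥ x = y ∧ ∀ z, sympForm x z = 0 → sympForm y z = 0 → sympForm x' z = 0 →
      sympForm y' z = 0 → τ.1 *ᵥ z = z := by
  obtain ⟨v, hxv, hvy, hv⟩ : ∃ v, sympForm x v ≠ 0 ∧ sympForm v y ≠ 0 ∧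
      ∀ z, sympForm x' z = 0 → sympForm y' z = 0 → sympForm v z = 0 := by
    rw [sympForm_swap, neg_ne_zero] at hy
    by_cases h₁ : sympForm x y' = 0
    · by_cases h₂ : sympForm x' y = 0
      · refine ⟨x' + y', ?_, ?_, fun z h h' => ?_⟩
        · rwa [sympForm_add_right, h₁, add_zero]
        · rwa [sympForm_add_left, h₂, zero_add]
        · rw [sympForm_add_left, h, h', add_zero]
      · exact ⟨x', hx, h₂, fun z h _ => h⟩
    · exact ⟨y', h₁, hy, fun z _ h => h⟩
  obtain ⟨τ, hτ, hτx, hτz⟩ := exists_mulVec_eq_of_sympForm_ne_zero₂ hT hxv hvy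
  exact ⟨τ, hτ, hτx, fun z h₁ h₂ h₃ h₄ =>
    hτz z (h₁.trans (hv z h₃ h₄).symm) ((hv z h₃ h₄).trans h₂.symm)⟩

lemma exists_mulVec_eq_and_fix {e f f' : l ⊕ l → F} (hf : sympForm e f = 1)
    (hf' : sympForm e f' = 1) :
    ∃ τ ∈ T, τ.1 *ᵥ e = e ∧ τ.1 *ᵥ f' = f ∧
      ∀ z, sympForm e z = 0 → sympForm f z = 0 → sympForm f' z = 0 → τ.1 *ᵥ z = z := by
  have hfe : sympForm f e = -1 := by rw [sympForm_swap, hf]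
  have hfe' : sympForm f' e = -1 := by rw [sympForm_swap, hf']
  by_cases h : sympForm f' f = 0
  · have h₁ : sympForm f' (f + e) ≠ 0 := by rw [sympForm_add_right, h, hfe']; simp
    have h₂ : sympForm (f + e) f ≠ 0 := by simp [sympForm_add_left, hf]
    obtain ⟨τ, hτ, hτx, hτz⟩ := exists_mulVec_eq_of_sympForm_ne_zero₂ hT h₁ h₂
    refine ⟨τ, hτ, hτz e ?_ ?_, hτx, fun z he hz hz' => hτz z ?_ ?_⟩ <;>
      simp [sympForm_add_left, *]
  · obtain ⟨τ, hτ, hτx, hτz⟩ := exists_mulVec_eq_of_sympForm_ne_zero hT h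
    exact ⟨τ, hτ, hτz e (hfe'.trans hfe.symm), hτx, fun z _ hz hz' => hτz z (hz'.trans hz.symm)⟩

lemma exists_mul_fix (A : symplecticGroup l F) (s : Finset l) :
    ∃ τ ∈ T, ∀ i ∈ s, (τ * A).1 *ᵥ Pi.single (Sum.inl i) 1 = Pi.single (Sum.inl i) 1 ∧
      (τ * A).1 *ᵥ Pi.single (Sum.inr i) 1 = Pi.single (Sum.inr i) 1 := by
  induction s using Finset.induction_on with
  | empty => exact ⟨1, T.one_mem, by simp⟩
  | insert j s hj ih =>
    obtain ⟨τ, hτ, hfix⟩ := ih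
    set B := τ * A
    set e : l ⊕ l → F := Pi.single (Sum.inr j) 1 with he
    set f : l ⊕ l → F := Pi.single (Sum.inl j) 1 with hf
    have hef : sympForm e f = 1 := by simp [he, hf, sympForm_single, J]
    have orth : ∀ i ∈ s, ∀ z, (z = Pi.single (Sum.inl i) 1 ∨ z = Pi.single (Sum.inr i) 1) →
        sympForm e z = 0 ∧ sympForm f z = 0 := by
      intro i hi z hz
      have hji : j ≠ i := fun h => hj (h ▸ hi)
      rcases hz with rfl | rfl <;> simp [he, hf, sympForm_single, J, hji]
    have fixB : ∀ i ∈ s, ∀ z, (z = Pi.single (Sum.inl i) 1 ∨ z = Pi.single (Sum.inr i) 1) →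
        B.1 *ᵥ z = z := by
      rintro i hi z (rfl | rfl)
      exacts [(hfix i hi).1, (hfix i hi).2]
    obtain ⟨σ, hσ, hσe, hσz⟩ := exists_mulVec_eq hT (x := B.1 *ᵥ e) (x' := B.1 *ᵥ f) (y := e)
      (y' := f) (by rw [sympForm_mulVec B.2, hef]; exact one_ne_zero) (by simp [hef])
    have fixC : ∀ i ∈ s, ∀ z, (z = Pi.single (Sum.inl i) 1 ∨ z = Pi.single (Sum.inr i) 1) →
        (σ * B).1 *ᵥ z = z := by
      intro i hi z hz
      obtain ⟨h₁, h₂⟩ := orth i hi z hz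
      have hB := fixB i hi z hz
      rw [Submonoid.coe_mul, ← mulVec_mulVec, hB]
      refine hσz z ?_ h₁ ?_ h₂
      · rw [← hB, sympForm_mulVec B.2, h₁]
      · rw [← hB, sympForm_mulVec B.2, h₂]
    have hCe : (σ * B).1 *ᵥ e = e := by rw [Submonoid.coe_mul, ← mulVec_mulVec, hσe]
    obtain ⟨ρ, hρ, hρe, hρf, hρz⟩ := exists_mulVec_eq_and_fix hT (e := e) (f := f)
      (f' := (σ * B).1 *ᵥ f) hef (by
        conv_lhs => rw [← hCe]
        rw [sympForm_mulVec (σ * B).2, hef])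
    refine ⟨ρ * σ * τ, T.mul_mem (T.mul_mem hρ hσ) hτ, fun i hi => ?_⟩
    have key : ρ * σ * τ * A = ρ * (σ * B) := by simp only [B, mul_assoc]
    rw [key, Submonoid.coe_mul, ← mulVec_mulVec, ← mulVec_mulVec]
    rcases Finset.mem_insert.1 hi with rfl | hi
    · exact ⟨hρf, by rw [hCe, hρe]⟩
    · have main : ∀ z, (z = Pi.single (Sum.inl i) 1 ∨ z = Pi.single (Sum.inr i) 1) →
          ρ.1 *ᵥ ((σ * B).1 *ᵥ z) = z := by
        intro z hz
        obtain ⟨h₁, h₂⟩ := orth i hi z hz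
        have hC := fixC i hi z hz
        rw [hC]
        refine hρz z h₁ h₂ ?_
        rw [← hC, sympForm_mulVec (σ * B).2, h₂]
      exact ⟨main _ (Or.inl rfl), main _ (Or.inr rfl)⟩

/-- The symplectic group over a field is generated by the symplectic transvections. -/
theorem eq_top_of_spTransvection_mem : T = ⊤ := by
  refine eq_top_iff.2 fun A _ => ?_
  obtain ⟨τ, hτ, h⟩ := exists_mul_fix hT A Finset.univ
  have : τ * A = 1 := by
    refine Subtype.ext (Matrix.ext_of_mulVec_single fun i => ?_)
    rcases i with i | i
    · exact (h i (Finset.mem_univ i)).1.trans (one_mulVec _).symm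
    · exact (h i (Finset.mem_univ i)).2.trans (one_mulVec _).symm
  rw [eq_inv_of_mul_eq_one_right this]
  exact T.inv_mem hτ

end Generation

section Perfect

variable {l F : Type*} [Fintype l] [DecidableEq l] [Field F]

/-- The symplectic group over a field in which `2` and `3` are invertible is perfect. -/
theorem commutator_symplecticGroup_eq_top (h2 : (2 : F) ≠ 0) (h3 : (3 : F) ≠ 0) :
    ⁅(⊤ : Subgroup (symplecticGroup l F)), (⊤ : Subgroup (symplecticGroup l F))⁆ = ⊤ := by
  refine eq_top_of_spTransvection_mem fun w c => ?_
  by_cases hw : ∃ v, sympForm w v ≠ 0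
  · obtain ⟨v, hv⟩ := hw
    obtain ⟨h, -, hh, -⟩ := exists_mulVec_eq (T := (⊤ : Subgroup (symplecticGroup l F)))
      (fun _ _ => Subgroup.mem_top _) (x := w) (y := (2 : F) • w) (x' := v) (y' := v) hv
      (by rw [sympForm_smul_left]; exact mul_ne_zero h2 hv)
    have key : h * spTransvection w (c / 3) =
        spTransvection w c * spTransvection w (c / 3) * h := by
      refine ext_mulVec_of_mem fun x => ?_
      simp only [Submonoid.coe_mul, ← mulVec_mulVec, spTransvection, sympTransvection_mulVec,
        mulVec_add, mulVec_smul, hh, sympForm_self]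
      have : sympForm w (h.1 *ᵥ x) = sympForm w x / 2 := by
        rw [← sympForm_mulVec h.2 w x, hh, sympForm_smul_left]
        field_simp
      rw [this, mul_zero, zero_smul, add_zero, add_assoc, ← add_smul, smul_smul]
      congr 2
      field_simp
      ring
    open scoped commutatorElement in
    have : spTransvection w c = ⁅h, spTransvection w (c / 3)⁆ := by
      rw [commutatorElement_def, key]
      group
    rw [this]
    exact Subgroup.commutator_mem_commutator (Subgroup.mem_top _) (Subgroup.mem_top _)
  · push Not at hw
    have : spTransvection w c = 1 :=
      ext_mulVec_of_mem fun x => by simp [spTransvection, sympTransvection_mulVec, hw]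
    rw [this]
    exact one_mem _

end Perfect

section PowerCongruence

variable {S R : Type*} [CommRing S] [Ring R] [Algebra S R] {p : ℕ}

lemma exists_one_add_pow_prime_eq_s4 (hp : p.Prime) (A : R) :
    ∃ C, (1 + A) ^ p = 1 + (p : S) • A + (p : S) • (A ^ 2 * C) + A ^ p := by
  have h := (Commute.one_right A).add_pow_prime_eq hp
  have hset : Finset.Ioo 0 p = insert 1 (Finset.Ioo 1 p) := by
    have := hp.two_le
    ext k
    simp only [Finset.mem_Ioo, Finset.mem_insert]
    omega
  refine ⟨∑ k ∈ Finset.Ioo 1 p, A ^ (k - 2) * ↑(p.choose k / p), ?_⟩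
  have hsum : ∑ k ∈ Finset.Ioo 1 p, A ^ (k - 1) * 1 ^ (p - k - 1) * ((p.choose k / p : ℕ) : R) =
      A * ∑ k ∈ Finset.Ioo 1 p, A ^ (k - 2) * ↑(p.choose k / p) := by
    rw [Finset.mul_sum]
    refine Finset.sum_congr rfl fun k hk => ?_
    obtain ⟨m, rfl⟩ : ∃ m, k = m + 2 := ⟨k - 2, by have := Finset.mem_Ioo.1 hk; omega⟩
    rw [show m + 2 - 1 = m + 1 by omega, show m + 2 - 2 = m by omega, one_pow, mul_one, pow_succ',
      mul_assoc]
  rw [hset, Finset.sum_insert (by simp), hsum] at h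
  simp only [Nat.choose_one_right, Nat.div_self hp.pos] at h
  rw [add_comm, h]
  simp only [Nat.cast_smul_eq_nsmul, nsmul_eq_mul]
  simp [mul_add, sq, mul_assoc]
  abel

lemma exists_one_add_pow_eq_of_sq_eq_zero (hp : p.Prime) (h4 : 4 ≤ p) {X : R} (hX : X * X = 0)
    (Y : R) :
    ∃ D, (1 + (X + (p : S) • Y)) ^ p = 1 + (p : S) • X + (p : S) ^ 2 • D := by
  obtain ⟨C, hC⟩ := exists_one_add_pow_prime_eq_s4 (S := S) hp (X + (p : S) • Y)
  obtain ⟨E, hE⟩ : ∃ E, (X + (p : S) • Y) ^ 2 = (p : S) • E := by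
    refine ⟨X * Y + Y * X + (p : S) • (Y * Y), ?_⟩
    simp only [sq, add_mul, mul_add, hX, smul_mul_assoc, mul_smul_comm]
    module
  obtain ⟨m, rfl⟩ : ∃ m, p = m + 4 := ⟨p - 4, by omega⟩
  generalize ((m + 4 : ℕ) : S) = q at *
  refine ⟨Y + E * C + E * E * (X + q • Y) ^ m, ?_⟩
  have h4 : (X + q • Y) ^ (m + 4) = q ^ 2 • (E * E * (X + q • Y) ^ m) := by
    rw [add_comm m 4, pow_add, show 4 = 2 + 2 from rfl, pow_add, hE]
    simp only [smul_mul_assoc, mul_smul_comm, smul_smul, sq]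
  rw [hC, h4, hE]
  simp only [smul_mul_assoc]
  module

lemma exists_one_add_smul_pow_eq (hp : p.Prime) (h3 : 3 ≤ p) (n : ℕ) (B : R) :
    ∃ D, (1 + (p : S) ^ (n + 1) • B) ^ p = 1 + (p : S) ^ (n + 2) • B + (p : S) ^ (n + 3) • D := by
  obtain ⟨C, hC⟩ := exists_one_add_pow_prime_eq_s4 (S := S) hp ((p : S) ^ (n + 1) • B)
  obtain ⟨m, rfl⟩ : ∃ m, p = m + 3 := ⟨p - 3, by omega⟩
  generalize ((m + 3 : ℕ) : S) = q at *
  refine ⟨q ^ n • (B ^ 2 * C) + q ^ (2 * n) • (B ^ 3 * (q ^ (n + 1) • B) ^ m), ?_⟩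
  rw [hC, add_comm m 3, pow_add (q ^ (n + 1) • B) 3 m, smul_pow, smul_pow _ _ 3]
  simp only [smul_mul_assoc]
  module

end PowerCongruence

section Lifting

variable {l : Type*} [Fintype l] [DecidableEq l]

lemma add_transpose_mem_of_vecMulVec_mem {n R : Type*} [Fintype n] [DecidableEq n] [CommRing R]
    {L : AddSubgroup (Matrix n n R)} (hL : ∀ w, vecMulVec w w ∈ L) (M : Matrix n n R) :
    M + Mᵀ ∈ L := by
  have h (v w : n → R) : vecMulVec v w + vecMulVec w v ∈ L := by
    have : vecMulVec v w + vecMulVec w v =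
        vecMulVec (v + w) (v + w) - vecMulVec v v - vecMulVec w w := by
      simp only [add_vecMulVec, vecMulVec_add]
      abel
    rw [this]
    exact L.sub_mem (L.sub_mem (hL _) (hL _)) (hL _)
  have hM : M + Mᵀ =
      ∑ i, (vecMulVec (Pi.single i 1) (M i) + vecMulVec (M i) (Pi.single i 1)) := by
    ext a b
    simp [Matrix.sum_apply, vecMulVec_apply, Finset.sum_add_distrib, Pi.single_apply]
  rw [hM]
  exact L.sum_mem fun i _ => h _ _

variable {ℓ : ℕ} [Fact (Nat.Prime ℓ)]

lemma exists_eq_add_smul_of_map_toZMod_eq {m n : Type*} {A B : Matrix m n ℤ_[ℓ]}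
    (h : A.map (PadicInt.toZMod : ℤ_[ℓ] →+* ZMod ℓ) = B.map PadicInt.toZMod) :
    ∃ C : Matrix m n ℤ_[ℓ], A = B + (ℓ : ℤ_[ℓ]) • C := by
  have key (i : m) (j : n) : ∃ c, A i j = B i j + ℓ * c := by
    have : A i j - B i j ∈ RingHom.ker (PadicInt.toZMod : ℤ_[ℓ] →+* ZMod ℓ) := by
      rw [RingHom.mem_ker, map_sub, sub_eq_zero]
      exact congrFun (congrFun h i) j
    rw [PadicInt.ker_toZMod, PadicInt.maximalIdeal_eq_span_p, Ideal.mem_span_singleton] at this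
    obtain ⟨c, hc⟩ := this
    exact ⟨c, by rw [← hc]; ring⟩
  choose C hC using key
  exact ⟨Matrix.of C, by ext i j; simp [hC i j]⟩

/-- The matrices `B` such that `K` contains an element congruent to `1 + ℓ ^ (n + 1) B`
modulo `ℓ ^ (n + 2)`. -/
def levelAddSubgroup {n : Type*} [Fintype n] [DecidableEq n] (K : Subgroup (Matrix n n ℤ_[ℓ])ˣ)
    (r : ℕ) : AddSubgroup (Matrix n n ℤ_[ℓ]) where
  carrier := {B | ∃ k ∈ K, ∃ C : Matrix n n ℤ_[ℓ],
    (k : Matrix n n ℤ_[ℓ]) = 1 + (ℓ : ℤ_[ℓ]) ^ (r + 1) • B + (ℓ : ℤ_[ℓ]) ^ (r + 2) • C}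
  zero_mem' := ⟨1, K.one_mem, 0, by simp⟩
  add_mem' := by
    rintro B B' ⟨k, hk, C, hC⟩ ⟨k', hk', C', hC'⟩
    refine ⟨k * k', K.mul_mem hk hk', C + C' + (ℓ : ℤ_[ℓ]) ^ r •
      ((B + (ℓ : ℤ_[ℓ]) • C) * (B' + (ℓ : ℤ_[ℓ]) • C')), ?_⟩
    rw [Units.val_mul, hC, hC']
    simp only [mul_add, add_mul, smul_mul_assoc, mul_smul_comm, mul_one, one_mul]
    module
  neg_mem' := by
    rintro B ⟨k, hk, C, hC⟩
    have h₁ : ((k⁻¹ : (Matrix n n ℤ_[ℓ])ˣ) : Matrix n n ℤ_[ℓ]) =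
        1 - (ℓ : ℤ_[ℓ]) ^ (r + 1) • ((B + (ℓ : ℤ_[ℓ]) • C) * (k⁻¹ : (Matrix n n ℤ_[ℓ])ˣ)) := by
      have h := k.mul_inv
      rw [hC] at h
      simp only [add_mul, smul_mul_assoc, one_mul] at h ⊢
      rw [← h]
      module
    refine ⟨k⁻¹, K.inv_mem hk, (ℓ : ℤ_[ℓ]) ^ r • ((B + (ℓ : ℤ_[ℓ]) • C) *
      ((B + (ℓ : ℤ_[ℓ]) • C) * (k⁻¹ : (Matrix n n ℤ_[ℓ])ˣ))) - C, ?_⟩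
    conv_lhs => rw [h₁, h₁]
    generalize ((k⁻¹ : (Matrix n n ℤ_[ℓ])ˣ) : Matrix n n ℤ_[ℓ]) = k'
    simp only [mul_add, add_mul, mul_sub, smul_mul_assoc, mul_smul_comm, mul_one]
    module

variable {K : Subgroup (Matrix (l ⊕ l) (l ⊕ l) ℤ_[ℓ])ˣ}

lemma vecMulVec_mul_J_mem_levelAddSubgroup (hℓ : 5 ≤ ℓ)
    (hsurj : ∀ B ∈ symplecticGroup l (ZMod ℓ), ∃ k ∈ K,
      (k : Matrix (l ⊕ l) (l ⊕ l) ℤ_[ℓ]).map (PadicInt.toZMod : ℤ_[ℓ] →+* ZMod ℓ) = B)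
    (r : ℕ) (w : l ⊕ l → ℤ_[ℓ]) : vecMulVec w w * J l ℤ_[ℓ] ∈ levelAddSubgroup K r := by
  have hp : ℓ.Prime := Fact.out
  induction r with
  | zero =>
    obtain ⟨k, hk, h⟩ := hsurj _ (SymplecticGroup.map_mem (sympTransvection_mem w 1)
      (PadicInt.toZMod : ℤ_[ℓ] →+* ZMod ℓ))
    obtain ⟨Y, hY⟩ := exists_eq_add_smul_of_map_toZMod_eq h
    obtain ⟨D, hD⟩ := exists_one_add_pow_eq_of_sq_eq_zero (S := ℤ_[ℓ]) hp (by omega)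
      (vecMulVec_mul_J_sq w) Y
    refine ⟨k ^ ℓ, K.pow_mem hk ℓ, D, ?_⟩
    rw [Units.val_pow_eq_pow_val, hY, sympTransvection, one_smul, add_assoc, hD]
    simp
  | succ r ih =>
    obtain ⟨k, hk, C, hC⟩ := ih
    obtain ⟨D, hD⟩ := exists_one_add_smul_pow_eq (S := ℤ_[ℓ]) hp (by omega) r
      (vecMulVec w w * J l ℤ_[ℓ] + (ℓ : ℤ_[ℓ]) • C)
    refine ⟨k ^ ℓ, K.pow_mem hk ℓ, C + D, ?_⟩
    have : (k : Matrix (l ⊕ l) (l ⊕ l) ℤ_[ℓ]) =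
        1 + (ℓ : ℤ_[ℓ]) ^ (r + 1) • (vecMulVec w w * J l ℤ_[ℓ] + (ℓ : ℤ_[ℓ]) • C) := by
      rw [hC]; module
    rw [Units.val_pow_eq_pow_val, this, hD]
    module

lemma mem_levelAddSubgroup_of_mem_symplecticGroup (hℓ : 5 ≤ ℓ)
    (hsurj : ∀ B ∈ symplecticGroup l (ZMod ℓ), ∃ k ∈ K,
      (k : Matrix (l ⊕ l) (l ⊕ l) ℤ_[ℓ]).map (PadicInt.toZMod : ℤ_[ℓ] →+* ZMod ℓ) = B)
    (r : ℕ) {B : Matrix (l ⊕ l) (l ⊕ l) ℤ_[ℓ]}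
    (hB : 1 + (ℓ : ℤ_[ℓ]) ^ (r + 1) • B ∈ symplecticGroup l ℤ_[ℓ]) :
    B ∈ levelAddSubgroup K r := by
  have hp : ℓ.Prime := Fact.out
  obtain ⟨t, ht⟩ : ∃ t : ℤ_[ℓ], 2 * t = 1 := by
    have : IsUnit (2 : ℤ_[ℓ]) := by
      have h := PadicInt.isUnit_iff.2 ((PadicInt.norm_natCast_eq_one_iff (p := ℓ) (n := 2)).2 ?_)
      · exact_mod_cast h
      · exact (Nat.coprime_primes hp Nat.prime_two).2 (by omega)
    exact this.exists_right_inv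
  set M := B * J l ℤ_[ℓ] with hM
  have hJ : B = -(M * J l ℤ_[ℓ]) := by simp [hM, Matrix.mul_assoc, J_squared]
  have hne : ((ℓ : ℤ_[ℓ]) ^ (r + 1)) ≠ 0 := pow_ne_zero _ (by exact_mod_cast hp.ne_zero)
  have hsymm : M = Mᵀ - (ℓ : ℤ_[ℓ]) ^ (r + 1) • (M * Bᵀ) := by
    rw [SymplecticGroup.mem_iff] at hB
    have hMt : Mᵀ = -(J l ℤ_[ℓ] * Bᵀ) := by rw [hM, transpose_mul, J_transpose, Matrix.neg_mul]
    simp only [transpose_add, transpose_one, transpose_smul, add_mul, mul_add, one_mul, mul_one,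
      smul_mul_assoc, mul_smul_comm, ← hM] at hB
    have h0 : (ℓ : ℤ_[ℓ]) ^ (r + 1) • (M - Mᵀ + (ℓ : ℤ_[ℓ]) ^ (r + 1) • (M * Bᵀ)) = 0 := by
      rw [hMt, ← sub_eq_zero.2 hB]
      module
    rw [smul_eq_zero_iff_right hne] at h0
    rw [← sub_eq_zero, ← h0]
    abel
  have hmem : ∀ N : Matrix (l ⊕ l) (l ⊕ l) ℤ_[ℓ],
      (N + Nᵀ) * J l ℤ_[ℓ] ∈ levelAddSubgroup K r := fun N =>
    add_transpose_mem_of_vecMulVec_mem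
      (L := (levelAddSubgroup K r).comap (AddMonoidHom.mulRight (J l ℤ_[ℓ])))
      (fun w => vecMulVec_mul_J_mem_levelAddSubgroup hℓ hsurj r w) N
  obtain ⟨k, hk, C, hC⟩ := (levelAddSubgroup K r).neg_mem (hmem (t • M))
  have hMM : M = t • M + (t • M)ᵀ - (ℓ : ℤ_[ℓ]) • ((ℓ : ℤ_[ℓ]) ^ r • (t • (M * Bᵀ))) := by
    calc M = (2 * t) • M := by rw [ht, one_smul]
      _ = t • M + t • M := by module
      _ = t • M + t • (Mᵀ - (ℓ : ℤ_[ℓ]) ^ (r + 1) • (M * Bᵀ)) := by rw [← hsymm]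
      _ = _ := by rw [transpose_smul]; module
  refine ⟨k, hk, C - (ℓ : ℤ_[ℓ]) ^ r • (t • (M * Bᵀ)) * J l ℤ_[ℓ], ?_⟩
  have hB' : B = -((t • M + (t • M)ᵀ) * J l ℤ_[ℓ]) +
      (ℓ : ℤ_[ℓ]) • ((ℓ : ℤ_[ℓ]) ^ r • (t • (M * Bᵀ)) * J l ℤ_[ℓ]) := by
    conv_lhs => rw [hJ, hMM]
    rw [sub_mul, smul_mul_assoc (ℓ : ℤ_[ℓ])]
    abel
  rw [hC]
  conv_rhs => enter [1, 2, 2]; rw [hB']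
  module

/-- A subgroup of `GL_{2g}(ℤ_ℓ)` that surjects onto `Sp_{2g}(𝔽_ℓ)` modulo `ℓ` approximates
every element of `Sp_{2g}(ℤ_ℓ)`, provided its elements are symplectic. -/
lemma exists_mem_eq_add_smul (hℓ : 5 ≤ ℓ)
    (hK : ∀ k ∈ K, (k : Matrix (l ⊕ l) (l ⊕ l) ℤ_[ℓ]) ∈ symplecticGroup l ℤ_[ℓ])
    (hsurj : ∀ B ∈ symplecticGroup l (ZMod ℓ), ∃ k ∈ K,
      (k : Matrix (l ⊕ l) (l ⊕ l) ℤ_[ℓ]).map (PadicInt.toZMod : ℤ_[ℓ] →+* ZMod ℓ) = B)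
    {x : (Matrix (l ⊕ l) (l ⊕ l) ℤ_[ℓ])ˣ}
    (hx : (x : Matrix (l ⊕ l) (l ⊕ l) ℤ_[ℓ]) ∈ symplecticGroup l ℤ_[ℓ]) (r : ℕ) :
    ∃ k ∈ K, ∃ C : Matrix (l ⊕ l) (l ⊕ l) ℤ_[ℓ],
      (k : Matrix (l ⊕ l) (l ⊕ l) ℤ_[ℓ]) = x + (ℓ : ℤ_[ℓ]) ^ (r + 1) • C := by
  induction r with
  | zero =>
    obtain ⟨k, hk, h⟩ := hsurj _ (SymplecticGroup.map_mem hx (PadicInt.toZMod : ℤ_[ℓ] →+* ZMod ℓ))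
    obtain ⟨C, hC⟩ := exists_eq_add_smul_of_map_toZMod_eq h
    exact ⟨k, hk, C, by rw [hC, zero_add, pow_one]⟩
  | succ r ih =>
    obtain ⟨k, hk, C, hC⟩ := ih
    have hx' : (k⁻¹ : (Matrix (l ⊕ l) (l ⊕ l) ℤ_[ℓ])ˣ).1 * x.1 =
        1 + (ℓ : ℤ_[ℓ]) ^ (r + 1) • -((k⁻¹ : (Matrix (l ⊕ l) (l ⊕ l) ℤ_[ℓ])ˣ).1 * C) := by
      rw [← k.inv_mul, hC, mul_add, mul_smul_comm]
      module
    have hmem := mul_mem (hK _ (K.inv_mem hk)) hx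
    rw [hx'] at hmem
    obtain ⟨k', hk', C', hC'⟩ := mem_levelAddSubgroup_of_mem_symplecticGroup hℓ hsurj r hmem
    refine ⟨k * k', K.mul_mem hk hk', k.1 * C', ?_⟩
    rw [Units.val_mul, hC', ← hx', mul_add, Units.mul_inv_cancel_left, mul_smul_comm]

lemma tendsto_add_smul_pow {m n : Type*} (A : Matrix m n ℤ_[ℓ]) (C : ℕ → Matrix m n ℤ_[ℓ]) :
    Filter.Tendsto (fun r => A + (ℓ : ℤ_[ℓ]) ^ (r + 1) • C r) Filter.atTop (nhds A) := by
  refine tendsto_pi_nhds.2 fun i => tendsto_pi_nhds.2 fun j => ?_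
  have h0 : Filter.Tendsto (fun r => (ℓ : ℤ_[ℓ]) ^ (r + 1) * C r i j) Filter.atTop (nhds 0) := by
    refine squeeze_zero_norm (a := fun r => ‖(ℓ : ℤ_[ℓ])‖ ^ (r + 1)) (fun r => ?_) ?_
    · rw [norm_mul, norm_pow]
      exact mul_le_of_le_one_right (by positivity) (PadicInt.norm_le_one _)
    · exact (tendsto_pow_atTop_nhds_zero_of_lt_one (norm_nonneg _)
        (PadicInt.norm_natCast_lt_one_iff.2 dvd_rfl)).comp (Filter.tendsto_add_atTop_nat 1)
  simpa using h0.const_add (A i j)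

lemma mem_closure_of_forall_exists_eq_add_smul {n : Type*} [Fintype n] [DecidableEq n]
    {s : Set (Matrix n n ℤ_[ℓ])ˣ} {x : (Matrix n n ℤ_[ℓ])ˣ}
    (h : ∀ r : ℕ, ∃ k ∈ s, ∃ C : Matrix n n ℤ_[ℓ],
      (k : Matrix n n ℤ_[ℓ]) = x + (ℓ : ℤ_[ℓ]) ^ (r + 1) • C) : x ∈ closure s := by
  choose k hk C hC using h
  refine mem_closure_of_tendsto (f := k) (b := Filter.atTop) ?_ (Filter.Eventually.of_forall hk)
  rw [Units.isInducing_embedProduct.tendsto_nhds_iff]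
  refine Filter.Tendsto.prodMk_nhds ?_ ((MulOpposite.continuous_op.tendsto _).comp ?_)
  · refine (tendsto_add_smul_pow x.1 C).congr fun r => (hC r).symm
  · refine (tendsto_add_smul_pow (x⁻¹).1 fun r => -((k r)⁻¹.1 * C r * (x⁻¹).1)).congr fun r => ?_
    have h₁ : (k r)⁻¹.1 * (k r).1 * (x⁻¹).1 = (x⁻¹).1 := by simp
    rw [hC, mul_add, add_mul, Units.mul_inv_cancel_right, mul_smul_comm, smul_mul_assoc] at h₁
    rw [smul_neg, ← sub_eq_add_neg, sub_eq_iff_eq_add]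
    exact h₁.symm

end Lifting

section Similitude

variable {l R : Type*} [Fintype l] [DecidableEq l] [CommRing R]

/-- The subgroup of invertible matrices which are symplectic. -/
def symplecticUnits (l R : Type*) [Fintype l] [DecidableEq l] [CommRing R] :
    Subgroup (Matrix (l ⊕ l) (l ⊕ l) R)ˣ where
  carrier := {x | (x : Matrix (l ⊕ l) (l ⊕ l) R) ∈ symplecticGroup l R}
  one_mem' := (symplecticGroup l R).one_mem
  mul_mem' := (symplecticGroup l R).mul_mem
  inv_mem' := by
    intro x hx
    have h := (⟨x.1, hx⟩ : symplecticGroup l R)⁻¹.2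
    rw [SymplecticGroup.coe_inv'] at h
    simpa [Matrix.coe_units_inv] using h

lemma similitude_mul {A B : Matrix (l ⊕ l) (l ⊕ l) R} {a b : R}
    (hA : A * J l R * Aᵀ = a • J l R) (hB : B * J l R * Bᵀ = b • J l R) :
    (A * B) * J l R * (A * B)ᵀ = (a * b) • J l R := by
  rw [transpose_mul, show A * B * J l R * (Bᵀ * Aᵀ) = A * (B * J l R * Bᵀ) * Aᵀ by
    simp only [Matrix.mul_assoc], hB, mul_smul_comm, smul_mul_assoc, hA, smul_smul, mul_comm]

lemma similitude_inv {x : (Matrix (l ⊕ l) (l ⊕ l) R)ˣ} {a : Rˣ}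
    (hx : x.1 * J l R * x.1ᵀ = (a : R) • J l R) :
    (x⁻¹).1 * J l R * (x⁻¹).1ᵀ = ((a⁻¹ : Rˣ) : R) • J l R := by
  have ht : x.1ᵀ * (x⁻¹).1ᵀ = 1 := by rw [← transpose_mul, x.inv_mul, transpose_one]
  have h : J l R = ((a⁻¹ : Rˣ) : R) • (x.1 * J l R * x.1ᵀ) := by rw [hx, smul_smul]; simp
  conv_lhs => rw [h]
  rw [mul_smul_comm, smul_mul_assoc, show (x⁻¹).1 * (x.1 * J l R * x.1ᵀ) * (x⁻¹).1ᵀ =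
    (x⁻¹).1 * x.1 * J l R * (x.1ᵀ * (x⁻¹).1ᵀ) by simp only [Matrix.mul_assoc], ht, x.inv_mul,
    one_mul, mul_one]

lemma commutator_le_symplecticUnits {H : Subgroup (Matrix (l ⊕ l) (l ⊕ l) R)ˣ}
    (hH : ∀ x ∈ H, ∃ κ : Rˣ, x.1 * J l R * x.1ᵀ = (κ : R) • J l R) :
    ⁅H, H⁆ ≤ symplecticUnits l R := by
  refine Subgroup.commutator_le.2 fun x hx y hy => ?_
  obtain ⟨a, ha⟩ := hH x hx
  obtain ⟨b, hb⟩ := hH y hy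
  have h := similitude_mul (similitude_mul (similitude_mul ha hb) (similitude_inv ha))
    (similitude_inv hb)
  have hab : (a * b * (a⁻¹ : Rˣ) * (b⁻¹ : Rˣ) : R) = 1 := by
    rw [mul_comm (a : R), mul_assoc (b : R), Units.mul_inv, mul_one, Units.mul_inv]
  rw [hab, one_smul] at h
  exact SymplecticGroup.mem_iff.2 h

lemma isClosed_symplecticUnits [TopologicalSpace R] [IsTopologicalRing R] [T2Space R] :
    IsClosed (symplecticUnits l R : Set (Matrix (l ⊕ l) (l ⊕ l) R)ˣ) := by
  have : (symplecticUnits l R : Set (Matrix (l ⊕ l) (l ⊕ l) R)ˣ) =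
      {x | x.1 * J l R * x.1ᵀ = J l R} := Set.ext fun x => SymplecticGroup.mem_iff
  rw [this]
  exact isClosed_eq ((Units.continuous_val.mul continuous_const).mul
    Units.continuous_val.matrix_transpose) continuous_const

lemma exists_mem_commutator_map_eq {F : Type*} [Field F] (h2 : (2 : F) ≠ 0) (h3 : (3 : F) ≠ 0)
    (f : R →+* F) {H : Subgroup (Matrix (l ⊕ l) (l ⊕ l) R)ˣ}
    (hH : ∀ B ∈ symplecticGroup l F, ∃ x ∈ H, x.1.map f = B) {B : Matrix (l ⊕ l) (l ⊕ l) F}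
    (hB : B ∈ symplecticGroup l F) : ∃ x ∈ ⁅H, H⁆, x.1.map f = B := by
  let φ : (Matrix (l ⊕ l) (l ⊕ l) R)ˣ →* (Matrix (l ⊕ l) (l ⊕ l) F)ˣ :=
    Units.map f.mapMatrix.toMonoidHom
  let ψ : symplecticGroup l F →* (Matrix (l ⊕ l) (l ⊕ l) F)ˣ :=
    (symplecticGroup l F).subtype.toHomUnits
  have hle : (⊤ : Subgroup (symplecticGroup l F)).map ψ ≤ H.map φ := by
    rintro _ ⟨A, -, rfl⟩
    obtain ⟨x, hx, hxA⟩ := hH A A.2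
    exact ⟨x, hx, Units.ext hxA⟩
  have hcomm := Subgroup.commutator_mono hle hle
  rw [← Subgroup.map_commutator, ← Subgroup.map_commutator,
    commutator_symplecticGroup_eq_top h2 h3] at hcomm
  obtain ⟨x, hx, h⟩ := hcomm ⟨⟨B, hB⟩, Subgroup.mem_top _, rfl⟩
  exact ⟨x, hx, congrArg Units.val h⟩

end Similitude

/-- Let `ℓ ≥ 5` be a prime and let `H` be a closed subgroup of `GSp_{2g}(ℤ_ℓ)` (realized as a
subgroup of `GL_{2g}(ℤ_ℓ)` all of whose elements are symplectic similitudes) whose reduction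
modulo `ℓ` contains `Sp_{2g}(𝔽_ℓ)`.  Then the closure of the commutator subgroup `H'` equals
`Sp_{2g}(ℤ_ℓ)`. -/
theorem closure_commutator_gsp_eq_sp (g ℓ : ℕ) [Fact (Nat.Prime ℓ)] (hℓ : 5 ≤ ℓ)
    (H : Subgroup (Matrix (Fin g ⊕ Fin g) (Fin g ⊕ Fin g) ℤ_[ℓ])ˣ)
    (hclosed : IsClosed (H : Set (Matrix (Fin g ⊕ Fin g) (Fin g ⊕ Fin g) ℤ_[ℓ])ˣ))
    (hGSp : ∀ x ∈ H, ∃ κ : ℤ_[ℓ]ˣ,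
      (x : Matrix (Fin g ⊕ Fin g) (Fin g ⊕ Fin g) ℤ_[ℓ]) * Matrix.J (Fin g) ℤ_[ℓ] *
        (x : Matrix (Fin g ⊕ Fin g) (Fin g ⊕ Fin g) ℤ_[ℓ])ᵀ
        = (κ : ℤ_[ℓ]) • Matrix.J (Fin g) ℤ_[ℓ])
    (hred : ∀ B ∈ Matrix.symplecticGroup (Fin g) (ZMod ℓ),
      ∃ x ∈ H, ((x : Matrix (Fin g ⊕ Fin g) (Fin g ⊕ Fin g) ℤ_[ℓ]).map
        (PadicInt.toZMod : ℤ_[ℓ] →+* ZMod ℓ)) = B) :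
    ∀ x : (Matrix (Fin g ⊕ Fin g) (Fin g ⊕ Fin g) ℤ_[ℓ])ˣ,
      x ∈ Subgroup.topologicalClosure ⁅H, H⁆ ↔
        (x : Matrix (Fin g ⊕ Fin g) (Fin g ⊕ Fin g) ℤ_[ℓ]) ∈
          Matrix.symplecticGroup (Fin g) ℤ_[ℓ] := by
  intro x
  have hle := commutator_le_symplecticUnits hGSp
  constructor
  · intro hx
    exact Subgroup.topologicalClosure_minimal _ hle isClosed_symplecticUnits hx
  · intro hx
    have hne (n : ℕ) (h0 : 0 < n) (hn : n < 5) : (n : ZMod ℓ) ≠ 0 := fun h =>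
      absurd (Nat.le_of_dvd h0 ((ZMod.natCast_eq_zero_iff n ℓ).1 h)) (by omega)
    exact mem_closure_of_forall_exists_eq_add_smul fun r =>
      exists_mem_eq_add_smul hℓ (fun k hk => hle hk)
        (fun B hB => exists_mem_commutator_map_eq (by exact_mod_cast hne 2 (by omega) (by omega))
          (by exact_mod_cast hne 3 (by omega) (by omega)) PadicInt.toZMod hred hB) hx r
end
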